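/- (Abel's theorem for 𝒦ₘ, reformulated) Let Φ: Div(ℂ* × ℤ/m) → ℂ* × ℤ/m be the summation map induced by the group structure on ℂ* × ℤ/m. A divisor D of degree 0 on ℂ* × ℤ/m is the divisor of an element of 𝒦ₘ if and only if Φ(D) = (1, 0). -/

import Mathlib

open Polynomial

/-- The order of vanishing of a rational function at `u = 0`
(positive for zeros, negative for poles). -/
noncomputable def ord0 (g : RatFunc ℂ) : ℤ :=
  (g.num.rootMultiplicity 0 : ℤ) - g.denom.rootMultiplicity 0

/-- The order of vanishing of a rational function at `u = ∞`, i.e. of `g(1/v)` at `v = 0`. -/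
noncomputable def ordInf (g : RatFunc ℂ) : ℤ := -g.intDegree

/-- The leading coefficient of the Laurent expansion of `g` at `u = 0`, i.e. the value of
`g(u)/u^{n₀(g)}` at `u = 0`. -/
noncomputable def c0 (g : RatFunc ℂ) : ℂ :=
  g.num.coeff (g.num.rootMultiplicity 0) / g.denom.coeff (g.denom.rootMultiplicity 0)

/-- The leading coefficient of the Laurent expansion of `g` at `u = ∞`, i.e. the value of
`g(u)·u^{n_∞(g)}` at `u = ∞`. -/
noncomputable def cInf (g : RatFunc ℂ) : ℂ := g.num.leadingCoeff / g.denom.leadingCoeff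

/-- The order of vanishing of a rational function at `x`. -/
noncomputable def ordAt (x : ℂ) (g : RatFunc ℂ) : ℤ :=
  (g.num.rootMultiplicity x : ℤ) - g.denom.rootMultiplicity x

/-- The function group `𝒦ₘ` of an `I_m` fiber: `m`-tuples of nonzero rational functions
with matching orders and leading Laurent coefficients at the nodes, whose orders sum to
zero around the cycle. -/
noncomputable def Kgroup (m : ℕ) [NeZero m] : Set (ZMod m → (RatFunc ℂ)ˣ) :=
  {g | (∀ j, ordInf (g j : RatFunc ℂ) + ord0 (g (j + 1) : RatFunc ℂ) = 0) ∧
       (∀ j, cInf (g j : RatFunc ℂ) = c0 (g (j + 1) : RatFunc ℂ)) ∧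
       (∑ j, ord0 (g j : RatFunc ℂ)) = 0}

/-- The degree of a divisor on `ℂ* × ℤ/m`: the sum of its coefficients. -/
noncomputable def divDeg (m : ℕ) (D : (ℂˣ × Multiplicative (ZMod m)) →₀ ℤ) : ℤ :=
  ∑ pt ∈ D.support, D pt

/-- The summation map `Φ : Div(ℂ* × ℤ/m) → ℂ* × ℤ/m`, sending a formal sum of points to
their actual sum in the group `ℂ* × ℤ/m` (written multiplicatively). -/
noncomputable def Phi (m : ℕ) (D : (ℂˣ × Multiplicative (ZMod m)) →₀ ℤ) :
    ℂˣ × Multiplicative (ZMod m) :=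
  ∏ pt ∈ D.support, pt ^ (D pt)

lemma aux_ordAt_mul (x : ℂ) (g h : RatFunc ℂ) (hg : g ≠ 0) (hh : h ≠ 0) :
    ordAt x (g * h) = ordAt x g + ordAt x h := by
  have key := RatFunc.num_denom_mul g h
  have h1 : (g * h).num ≠ 0 := RatFunc.num_ne_zero (mul_ne_zero hg hh)
  have h2 := RatFunc.num_ne_zero hg
  have h3 := RatFunc.num_ne_zero hh
  have h4 := RatFunc.denom_ne_zero g
  have h5 := RatFunc.denom_ne_zero h
  have h6 := RatFunc.denom_ne_zero (g * h)
  have := congrArg (rootMultiplicity x) key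
  rw [rootMultiplicity_mul (by positivity), rootMultiplicity_mul (by positivity),
    rootMultiplicity_mul (by positivity), rootMultiplicity_mul (by positivity)] at this
  unfold ordAt
  omega

lemma aux_c0_eq (g : RatFunc ℂ) : c0 g = g.num.trailingCoeff / g.denom.trailingCoeff := by
  unfold c0
  rw [rootMultiplicity_eq_natTrailingDegree', rootMultiplicity_eq_natTrailingDegree']
  rfl

/-- `c0` as a monoid hom. -/
noncomputable def auxC0 : RatFunc ℂ →* ℂ where
  toFun := c0
  map_one' := by simp [aux_c0_eq]
  map_mul' g h := by
    have key := congrArg trailingCoeff (RatFunc.num_denom_mul g h)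
    simp only [trailingCoeff_mul] at key
    have h4 := mt trailingCoeff_eq_zero.1 (RatFunc.denom_ne_zero g)
    have h5 := mt trailingCoeff_eq_zero.1 (RatFunc.denom_ne_zero h)
    have h6 := mt trailingCoeff_eq_zero.1 (RatFunc.denom_ne_zero (g * h))
    rw [aux_c0_eq, aux_c0_eq, aux_c0_eq]
    field_simp
    linear_combination key

/-- `cInf` as a monoid hom. -/
noncomputable def auxCInf : RatFunc ℂ →* ℂ where
  toFun := cInf
  map_one' := by simp [cInf]
  map_mul' g h := by
    have key := congrArg leadingCoeff (RatFunc.num_denom_mul g h)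
    simp only [leadingCoeff_mul] at key
    have h4 := mt leadingCoeff_eq_zero.1 (RatFunc.denom_ne_zero g)
    have h5 := mt leadingCoeff_eq_zero.1 (RatFunc.denom_ne_zero h)
    have h6 := mt leadingCoeff_eq_zero.1 (RatFunc.denom_ne_zero (g * h))
    unfold cInf
    field_simp
    linear_combination key

/-- `ordAt` as a monoid hom. -/
noncomputable def auxOrd (x : ℂ) : (RatFunc ℂ)ˣ →* Multiplicative ℤ where
  toFun g := Multiplicative.ofAdd (ordAt x g)
  map_one' := by simp [ordAt]
  map_mul' g h := by
    rw [Units.val_mul, aux_ordAt_mul x _ _ g.ne_zero h.ne_zero]; rfl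

/-- degree as a monoid hom. -/
noncomputable def auxDeg : (RatFunc ℂ)ˣ →* Multiplicative ℤ where
  toFun g := Multiplicative.ofAdd (RatFunc.intDegree (g : RatFunc ℂ))
  map_one' := by simp
  map_mul' g h := by
    rw [Units.val_mul, RatFunc.intDegree_mul g.ne_zero h.ne_zero]; rfl

/-- linear factor -/
noncomputable def auxLin (x : ℂ) : (RatFunc ℂ)ˣ :=
  Units.mk0 (algebraMap ℂ[X] (RatFunc ℂ) (X - C x))
    (RatFunc.algebraMap_ne_zero (X_sub_C_ne_zero x))

/-- constants -/
noncomputable def auxConst (a : ℂˣ) : (RatFunc ℂ)ˣ :=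
  Units.mk0 (algebraMap ℂ[X] (RatFunc ℂ) (C (a : ℂ)))
    (RatFunc.algebraMap_ne_zero (C_ne_zero.2 a.ne_zero))

lemma aux_ord_lin (x y : ℂ) : ordAt y (auxLin x) = if y = x then 1 else 0 := by
  simp [ordAt, auxLin, RatFunc.num_algebraMap, RatFunc.denom_algebraMap, rootMultiplicity_X_sub_C,
    -map_sub]

lemma aux_ord_const (a : ℂˣ) (y : ℂ) : ordAt y (auxConst a) = 0 := by
  simp [ordAt, auxConst, RatFunc.num_algebraMap, RatFunc.denom_algebraMap, -RatFunc.algebraMap_C]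

lemma aux_deg_lin (x : ℂ) : RatFunc.intDegree (auxLin x : RatFunc ℂ) = 1 := by
  simp [auxLin, RatFunc.intDegree_polynomial, -map_sub]

lemma aux_deg_const (a : ℂˣ) : RatFunc.intDegree (auxConst a : RatFunc ℂ) = 0 := by
  simp [auxConst]

lemma aux_cInf_lin (x : ℂ) : cInf (auxLin x) = 1 := by
  simp [cInf, auxLin, RatFunc.num_algebraMap, RatFunc.denom_algebraMap, -map_sub]

lemma aux_cInf_const (a : ℂˣ) : cInf (auxConst a) = a := by
  simp [cInf, auxConst, RatFunc.num_algebraMap, RatFunc.denom_algebraMap, -RatFunc.algebraMap_C]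

lemma aux_rm_one : rootMultiplicity (0 : ℂ) (1 : ℂ[X]) = 0 :=
  rootMultiplicity_eq_zero (by simp)

lemma aux_c0_const (a : ℂˣ) : c0 (auxConst a) = a := by
  simp [c0, aux_rm_one, auxConst, RatFunc.num_algebraMap, RatFunc.denom_algebraMap, -RatFunc.algebraMap_C]

lemma aux_c0_lin (x : ℂˣ) : c0 (auxLin x) = -x := by
  simp [c0, aux_rm_one, auxLin, RatFunc.num_algebraMap, RatFunc.denom_algebraMap,
    rootMultiplicity_X_sub_C,
    -map_sub, x.ne_zero.symm]

lemma aux_c0_lin0 : c0 (auxLin 0) = 1 := by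
  have : rootMultiplicity (0 : ℂ) X = 1 := by
    simpa using rootMultiplicity_X_sub_C_self (x := (0 : ℂ))
  simp [c0, this, aux_rm_one, auxLin, RatFunc.num_algebraMap, RatFunc.denom_algebraMap,
    -RatFunc.algebraMap_X]

/-- The subgroup of functions satisfying the basic degree/leading coefficient formulas. -/
noncomputable def auxS : Subgroup (RatFunc ℂ)ˣ where
  carrier := {g | ∃ d : ℂˣ →₀ ℤ, (∀ x : ℂˣ, auxOrd x g = Multiplicative.ofAdd (d x)) ∧
    auxDeg g = auxOrd 0 g * Multiplicative.ofAdd (d.sum fun _ k => k) ∧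
    Units.map auxC0 g = Units.map auxCInf g * d.prod fun x k => (-x) ^ k}
  one_mem' := ⟨0, by simp, by simp, by simp⟩
  mul_mem' := by
    rintro g h ⟨d, h1, h2, h3⟩ ⟨e, k1, k2, k3⟩
    refine ⟨d + e, fun x => ?_, ?_, ?_⟩
    · rw [map_mul, h1, k1]; rfl
    · rw [map_mul, h2, k2, map_mul, Finsupp.sum_add_index' (by simp) (by simp), ofAdd_add]
      exact mul_mul_mul_comm _ _ _ _
    · rw [map_mul, h3, k3, map_mul, Finsupp.prod_add_index' (by simp)
        (fun a b c => zpow_add _ _ _)]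
      exact mul_mul_mul_comm _ _ _ _
  inv_mem' := by
    rintro g ⟨d, h1, h2, h3⟩
    refine ⟨-d, fun x => ?_, ?_, ?_⟩
    · rw [map_inv, h1]; rfl
    · rw [map_inv, h2, map_inv, Finsupp.sum_neg_index (by simp), mul_inv, ← ofAdd_neg]
      simp [Finsupp.sum]
    · rw [map_inv, h3, map_inv, Finsupp.prod_neg_index (by simp), mul_inv]
      simp [Finsupp.prod]

lemma aux_const_mem (a : ℂˣ) : auxConst a ∈ auxS := by
  refine ⟨0, fun x => ?_, ?_, ?_⟩
  · simp [auxOrd, aux_ord_const]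
  · simp [auxOrd, aux_ord_const, auxDeg, aux_deg_const]
  · ext; simp [auxC0, auxCInf, aux_c0_const, aux_cInf_const]

lemma aux_lin_mem (x : ℂ) : auxLin x ∈ auxS := by
  by_cases hx : x = 0
  · subst hx
    refine ⟨0, fun x => ?_, ?_, ?_⟩
    · simp [auxOrd, aux_ord_lin]
    · simp [auxOrd, aux_ord_lin, auxDeg, aux_deg_lin]
    · ext; simp [auxC0, auxCInf, aux_c0_lin0, aux_cInf_lin]
  · lift x to ℂˣ using (isUnit_iff_ne_zero.2 hx)
    refine ⟨Finsupp.single x 1, fun y => ?_, ?_, ?_⟩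
    · simp [auxOrd, aux_ord_lin, Finsupp.single_apply, Units.val_inj, eq_comm (a := x)]
    · simp [auxOrd, aux_ord_lin, auxDeg, aux_deg_lin, x.ne_zero.symm]
    · ext; simp [auxC0, auxCInf, aux_c0_lin, aux_cInf_lin]

lemma aux_poly_mem (p : ℂ[X]) (hp : p ≠ 0) :
    Units.mk0 (algebraMap ℂ[X] (RatFunc ℂ) p) (RatFunc.algebraMap_ne_zero hp) ∈ auxS := by
  have hs : ∀ s : Multiset ℂ, ∃ u ∈ auxS,
      ((u : (RatFunc ℂ)ˣ) : RatFunc ℂ) = algebraMap ℂ[X] (RatFunc ℂ) (s.map (X - C ·)).prod := by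
    intro s
    induction s using Multiset.induction_on with
    | empty => exact ⟨1, one_mem _, by simp⟩
    | cons a s ih =>
      obtain ⟨u, hu, e⟩ := ih
      refine ⟨auxLin a * u, mul_mem (aux_lin_mem a) hu, ?_⟩
      rw [Multiset.map_cons, Multiset.prod_cons, map_mul, Units.val_mul, e]; rfl
  obtain ⟨u, hu, e⟩ := hs p.roots
  have hsp := (IsAlgClosed.splits p).eq_prod_roots
  have hl : p.leadingCoeff ≠ 0 := leadingCoeff_ne_zero.2 hp
  convert mul_mem (aux_const_mem (Units.mk0 _ hl)) hu
  ext
  rw [Units.val_mul, e]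
  simp only [auxConst, Units.val_mk0]
  rw [← map_mul, ← hsp]

lemma aux_mem (g : (RatFunc ℂ)ˣ) : g ∈ auxS := by
  convert div_mem (aux_poly_mem _ (RatFunc.num_ne_zero g.ne_zero))
    (aux_poly_mem _ (RatFunc.denom_ne_zero (g : RatFunc ℂ)))
  ext
  simp [RatFunc.num_div_denom]

lemma aux_formulas (g : (RatFunc ℂ)ˣ) (d : ℂˣ →₀ ℤ) (h : ∀ x : ℂˣ, d x = ordAt x g) :
    RatFunc.intDegree (g : RatFunc ℂ) = ord0 g + d.sum (fun _ k => k) ∧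
    Units.map auxC0 g = Units.map auxCInf g * d.prod fun x k => (-x) ^ k := by
  obtain ⟨e, h1, h2, h3⟩ := aux_mem g
  obtain rfl : d = e := by
    ext x
    rw [h]
    exact Multiplicative.ofAdd.injective (h1 x)
  exact ⟨Multiplicative.ofAdd.injective h2, h3⟩

lemma aux_exists (n : ℤ) (a : ℂˣ) (d : ℂˣ →₀ ℤ) : ∃ g : (RatFunc ℂ)ˣ,
    ord0 g = n ∧ Units.map auxCInf g = a ∧ ∀ x : ℂˣ, d x = ordAt x g := by
  refine ⟨auxConst a * auxLin 0 ^ n * d.prod fun x k => auxLin x ^ k, ?_, ?_, fun y => ?_⟩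
  · apply Multiplicative.ofAdd.injective
    change auxOrd 0 _ = _
    have h1 : auxOrd 0 (auxConst a) = 1 := by simp [auxOrd, aux_ord_const]
    have h2 : auxOrd 0 (auxLin 0) = Multiplicative.ofAdd 1 := by simp [auxOrd, aux_ord_lin]
    have h3 : ∀ x : ℂˣ, auxOrd 0 (auxLin x) = 1 := fun x => by
      simp [auxOrd, aux_ord_lin, x.ne_zero.symm]
    rw [map_mul, map_mul, map_finsuppProd]
    simp only [map_zpow, h1, h2, h3]
    simp [← ofAdd_zsmul, Finsupp.prod]
  · have h1 : Units.map auxCInf (auxConst a) = a := by ext; simp [auxCInf, aux_cInf_const]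
    have h2 : ∀ x, Units.map auxCInf (auxLin x) = 1 := fun x => by
      ext; simp [auxCInf, aux_cInf_lin]
    rw [map_mul, map_mul, map_finsuppProd]
    simp only [map_zpow, h1, h2]
    simp [Finsupp.prod]
  · apply Multiplicative.ofAdd.injective
    change _ = auxOrd y _
    have h1 : auxOrd y (auxConst a) = 1 := by simp [auxOrd, aux_ord_const]
    have h2 : auxOrd y (auxLin 0) = 1 := by simp [auxOrd, aux_ord_lin]
    have h3 : ∀ x : ℂˣ, auxOrd y (auxLin x) = if y = x then Multiplicative.ofAdd 1 else 1 :=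
      fun x => by
        have h := aux_ord_lin x y
        change Multiplicative.ofAdd (ordAt y (auxLin x)) = _
        rw [h]
        simp only [Units.val_inj]
        split_ifs <;> rfl
    rw [map_mul, map_mul, map_finsuppProd]
    simp only [map_zpow, h1, h2, h3]
    simp only [one_zpow, one_mul, Finsupp.prod, ite_pow]
    rw [Finset.prod_ite_eq]
    by_cases hy : d y = 0 <;> simp [hy, ← ofAdd_zsmul]

lemma aux_cycle {A : Type*} [AddCommGroup A] (m : ℕ) [NeZero m] (s : ZMod m → A)
    (hs : ∑ j, s j = 0) : ∃ n : ZMod m → A, ∀ j, n (j + 1) = n j + s j := by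
  refine ⟨fun j => ∑ i ∈ Finset.range j.val, s (i : ZMod m), fun j => ?_⟩
  have hj : s j = s ((j.val : ℕ) : ZMod m) := by rw [ZMod.natCast_zmod_val]
  rw [hj, ← Finset.sum_range_succ]
  have hlt := ZMod.val_lt j
  have hval : (j + 1).val = (j.val + 1) % m := by
    rw [← ZMod.val_natCast]; simp
  dsimp only
  rw [hval]
  by_cases h : j.val + 1 < m
  · rw [Nat.mod_eq_of_lt h]
  · have : j.val + 1 = m := by omega
    rw [this, Nat.mod_self, Finset.range_zero, Finset.sum_empty, ← hs]
    refine Finset.sum_bij' (fun j _ => j.val) (fun i _ => (i : ZMod m)) ?_ ?_ ?_ ?_ ?_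
    · intro a _; exact Finset.mem_range.2 (ZMod.val_lt a)
    · simp
    · simp
    · intro a ha; exact ZMod.val_cast_of_lt (Finset.mem_range.1 ha)
    · simp

lemma aux_A0 (m : ℕ) [NeZero m] (s n : ZMod m → ℤ) (hn : ∀ j, n (j + 1) = n j + s j) :
    ∑ j, s j • j = -((∑ j, n j : ℤ) : ZMod m) := by
  have h1 : ∑ j : ZMod m, n (j + 1) • j = ∑ j : ZMod m, n j • (j - 1) := by
    rw [← Equiv.sum_comp (Equiv.addRight (1 : ZMod m)) (fun j => n j • (j - 1))]
    simp
  have h2 : ∀ j, s j • j = n (j + 1) • j - n j • j := fun j => by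
    rw [hn, add_smul]; abel
  simp_rw [h2, Finset.sum_sub_distrib, h1, smul_sub, Finset.sum_sub_distrib]
  simp

lemma aux_A (m : ℕ) [NeZero m] (s : ZMod m → ℤ) (hs : ∑ j, s j = 0) :
    (∑ j, s j • j = 0) ↔
      ∃ n : ZMod m → ℤ, (∀ j, n (j + 1) = n j + s j) ∧ ∑ j, n j = 0 := by
  constructor
  · intro h
    obtain ⟨n, hn⟩ := aux_cycle m s hs
    have := aux_A0 m s n hn
    rw [h, eq_comm, neg_eq_zero, ZMod.intCast_zmod_eq_zero_iff_dvd] at this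
    obtain ⟨k, hk⟩ := this
    refine ⟨fun j => n j - k, fun j => by
      dsimp only
      rw [hn]; ring, ?_⟩
    rw [Finset.sum_sub_distrib, hk]
    simp [ZMod.card]
  · rintro ⟨n, hn, h⟩
    rw [aux_A0 m s n hn, h]; simp

lemma aux_B (m : ℕ) [NeZero m] (r : ZMod m → ℂˣ) :
    (∏ j, r j = 1) ↔ ∃ a : ZMod m → ℂˣ, ∀ j, a j = a (j + 1) * r (j + 1) := by
  have shift : ∀ f : ZMod m → ℂˣ, ∏ j, f (j + 1) = ∏ j, f j := fun f =>
    Equiv.prod_comp (Equiv.addRight (1 : ZMod m)) f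
  constructor
  · intro h
    obtain ⟨n, hn⟩ := aux_cycle (A := Additive ℂˣ) m (fun j => Additive.ofMul (r (j + 1))⁻¹) (by
      rw [← ofMul_prod, Finset.prod_inv_distrib, shift, h]; simp)
    refine ⟨fun j => (n j).toMul, fun j => ?_⟩
    dsimp only
    rw [hn]; simp
  · rintro ⟨a, ha⟩
    have : ∏ j, a j = ∏ j, (a (j + 1) * r (j + 1)) := Finset.prod_congr rfl fun j _ => ha j
    rw [Finset.prod_mul_distrib, shift, shift] at this
    exact left_eq_mul.1 this

/-- Abel's theorem for `𝒦ₘ`: a divisor `D` of degree `0` on `ℂ* × ℤ/m` is the divisor of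
an element of `𝒦ₘ` if and only if `Φ(D) = (1, 0)`. -/
theorem abel_theorem (m : ℕ) [NeZero m]
    (D : (ℂˣ × Multiplicative (ZMod m)) →₀ ℤ) (hdeg : divDeg m D = 0) :
    Phi m D = 1 ↔
      ∃ g ∈ Kgroup m, ∀ (x : ℂˣ) (j : ZMod m),
        D (x, Multiplicative.ofAdd j) = ordAt (x : ℂ) ((g j : RatFunc ℂ)) := by
  classical
  let T : Finset ℂˣ := D.support.image Prod.fst
  have hsub : D.support ⊆ T ×ˢ (Finset.univ : Finset (Multiplicative (ZMod m))) := by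
    intro p hp
    simp only [Finset.mem_product, Finset.mem_univ, and_true]
    exact Finset.mem_image_of_mem _ hp
  let d : ZMod m → (ℂˣ →₀ ℤ) := fun j =>
    Finsupp.onFinset T (fun x => D (x, Multiplicative.ofAdd j)) (fun x hx =>
      Finset.mem_image.2 ⟨_, Finsupp.mem_support_iff.2 hx, rfl⟩)
  have hd : ∀ j x, d j x = D (x, Multiplicative.ofAdd j) := fun j x => rfl
  have hdT : ∀ j, (d j).support ⊆ T := fun j => Finsupp.support_onFinset_subset
  let s : ZMod m → ℤ := fun j => (d j).sum fun _ k => k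
  let r : ZMod m → ℂˣ := fun j => (d j).prod fun x k => (-x) ^ k
  have hsT : ∀ j, s j = ∑ x ∈ T, D (x, Multiplicative.ofAdd j) := fun j =>
    Finsupp.sum_of_support_subset _ (hdT j) _ (by simp)
  have hrT : ∀ j, r j = ∏ x ∈ T, (-x) ^ D (x, Multiplicative.ofAdd j) := fun j =>
    Finsupp.prod_of_support_subset _ (hdT j) _ (by simp)
  have hs0 : ∑ j, s j = 0 := by
    rw [← hdeg, divDeg, Finset.sum_subset hsub (by simp), Finset.sum_product_right]
    simp_rw [hsT]
    exact Equiv.sum_comp (Multiplicative.ofAdd (α := ZMod m)) (fun j => ∑ x ∈ T, D (x, j))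
  have hPhi : Phi m D = ∏ j : ZMod m, ∏ x ∈ T,
      (x, Multiplicative.ofAdd j) ^ D (x, Multiplicative.ofAdd j) := by
    rw [Phi, Finset.prod_subset hsub (by simp +contextual), Finset.prod_product_right]
    exact (Equiv.prod_comp (Multiplicative.ofAdd (α := ZMod m))
      (fun j => ∏ x ∈ T, (x, j) ^ D (x, j))).symm
  have hr : ∏ j, r j = (Phi m D).1 := by
    have h1 : ∀ j, r j = (-1) ^ s j * ∏ x ∈ T, x ^ D (x, Multiplicative.ofAdd j) := by
      intro j
      have : ∀ t : Finset ℂˣ, ∀ f : ℂˣ → ℤ,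
          ∏ x ∈ t, (-1 : ℂˣ) ^ f x = (-1) ^ ∑ x ∈ t, f x := by
        intro t f
        induction t using Finset.induction_on with
        | empty => simp
        | insert a t ha ih => rw [Finset.prod_insert ha, Finset.sum_insert ha, zpow_add, ih]
      rw [hrT, hsT, ← this, ← Finset.prod_mul_distrib]
      refine Finset.prod_congr rfl fun x _ => ?_
      rw [← mul_zpow]; simp
    have h2 : ∀ t : Finset (ZMod m),
          ∏ x ∈ t, (-1 : ℂˣ) ^ s x = (-1) ^ ∑ x ∈ t, s x := by
        intro t
        induction t using Finset.induction_on with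
        | empty => simp
        | insert a t ha ih => rw [Finset.prod_insert ha, Finset.sum_insert ha, zpow_add, ih]
    simp_rw [h1, Finset.prod_mul_distrib, h2, hs0, hPhi, Prod.fst_prod, Prod.pow_fst]
    simp
  have hn : Multiplicative.ofAdd (∑ j, s j • j) = (Phi m D).2 := by
    simp_rw [hPhi, Prod.snd_prod, Prod.pow_snd, ofAdd_sum]
    refine Finset.prod_congr rfl fun j _ => ?_
    rw [hsT, Finset.sum_smul, ofAdd_sum]
    rfl
  have hiff : Phi m D = 1 ↔ (∏ j, r j = 1) ∧ ∑ j, s j • j = 0 := by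
    rw [Prod.ext_iff, hr, ← hn]; rfl
  rw [hiff, aux_A m s hs0, aux_B]
  constructor
  · rintro ⟨⟨a, ha⟩, n, hn, hn0⟩
    choose g h1 h2 h3 using fun j => aux_exists (n j) (a j) (d j)
    refine ⟨g, ⟨fun j => ?_, fun j => ?_, ?_⟩, fun x j => h3 j x⟩
    · have := (aux_formulas (g j) (d j) (h3 j)).1
      rw [ordInf, this, h1, h1, hn]
      change -(n j + s j) + (n j + s j) = 0
      ring
    · have := (aux_formulas (g (j + 1)) (d (j + 1)) (h3 (j + 1))).2
      have h : Units.map auxCInf (g j) = Units.map auxC0 (g (j + 1)) := by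
        rw [this, h2, h2, ha]
      exact congrArg Units.val h
    · simp_rw [h1]; exact hn0
  · rintro ⟨g, ⟨k1, k2, k3⟩, h3⟩
    refine ⟨⟨fun j => Units.map auxCInf (g j), fun j => ?_⟩, fun j => ord0 (g j), fun j => ?_, k3⟩
    · have := (aux_formulas (g (j + 1)) (d (j + 1)) (fun x => h3 x (j + 1))).2
      dsimp only
      rw [← this]
      exact Units.ext (k2 j)
    · have h1 := (aux_formulas (g j) (d j) (fun x => h3 x j)).1
      have h2 := k1 j
      rw [ordInf, h1] at h2
      change _ = _ + (d j).sum fun _ k => k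
      linarith
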